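/- Consider a finite concurrent reachability game ⟨C,⊤⟩ such that every local interaction F_q (q ∈ Q) is a reach-maximizable game form. Then every state is maximizable: Q = MaxQ_A. -/

import Mathlib

open scoped BigOperators Classical

noncomputable section

/-- A probability distribution on a finite type. -/
def FDist (X : Type) [Fintype X] : Type :=
  { p : X → ℝ // (∀ x, 0 ≤ p x) ∧ ∑ x, p x = 1 }

namespace CRG

variable {A B Q D : Type} [Fintype A] [Fintype B] [Fintype Q] [Fintype D]

/-- The support of a distribution. -/
def supp {X : Type} [Fintype X] (σ : FDist X) : Set X := { x | σ.1 x ≠ 0 }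

/-- The Dirac distribution. -/
def dirac {X : Type} [Fintype X] [DecidableEq X] (x : X) : FDist X :=
  ⟨fun y => if y = x then 1 else 0, by
    constructor
    · intro y
      dsimp only
      split <;> norm_num
    · simp⟩

/-- Outcome of a pair of mixed strategies in the game in normal form with payoff `u`. -/
def out (u : A → B → ℝ) (σA : FDist A) (σB : FDist B) : ℝ :=
  ∑ a, ∑ b, σA.1 a * σB.1 b * u a b

/-- Outcome of a mixed strategy of Player A against a pure action of Player B. -/
def outB (u : A → B → ℝ) (σA : FDist A) (b : B) : ℝ :=
  ∑ a, σA.1 a * u a b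

/-- The value of a Player A mixed strategy in a game in normal form. -/
def valStratGF (u : A → B → ℝ) (σA : FDist A) : ℝ :=
  ⨅ σB : FDist B, out u σA σB

/-- The (von Neumann) value of a finite game in normal form. -/
def valGF (u : A → B → ℝ) : ℝ :=
  ⨆ σA : FDist A, valStratGF u σA

/-- The optimal Player A mixed strategies in a game in normal form. -/
def OptA (u : A → B → ℝ) : Set (FDist A) := { σA | valStratGF u σA = valGF u }

/-- The optimal actions of Player B against the Player A mixed strategy `σA`. -/
def optActs (u : A → B → ℝ) (σA : FDist A) : Set B :=
  { b | outB u σA b = valStratGF u σA }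

/-- μ_v : the lift of a valuation of the states to the Nature states. -/
def lift (dist : D → FDist Q) (v : Q → ℝ) (d : D) : ℝ := ∑ q, (dist d).1 q * v q

/-- The payoff function of the local interaction `F_q` valued by `μ_m`. -/
def locPay (δ : Q → A → B → D) (dist : D → FDist Q) (m : Q → ℝ) (q : Q) : A → B → ℝ :=
  fun a b => lift dist m (δ q a b)

/-- One-step transition probability between states. -/
def step (δ : Q → A → B → D) (dist : D → FDist Q) (σA : FDist A) (σB : FDist B)
    (q q' : Q) : ℝ :=
  ∑ a, ∑ b, σA.1 a * σB.1 b * (dist (δ q a b)).1 q'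

/-- The operator Δ on valuations of the states. -/
def Δop (δ : Q → A → B → D) (dist : D → FDist Q) (T : Q) (v : Q → ℝ) : Q → ℝ :=
  fun q => if q = T then 1 else valGF (fun a b => lift dist v (δ q a b))

/-- The target `T` is an absorbing (self-looping) sink. -/
def Absorbing (δ : Q → A → B → D) (dist : D → FDist Q) (T : Q) : Prop :=
  ∀ a b, (dist (δ T a b)).1 = fun q => if q = T then 1 else 0

/-- `m` is the least fixed point of Δ on `[0,1]^Q`. -/
def IsLfpDelta (δ : Q → A → B → D) (dist : D → FDist Q) (T : Q) (m : Q → ℝ) : Prop :=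
  (∀ q, m q ∈ Set.Icc (0:ℝ) 1) ∧ Δop δ dist T m = m ∧
    ∀ v : Q → ℝ, (∀ q, v q ∈ Set.Icc (0:ℝ) 1) → Δop δ dist T v = v → ∀ q, m q ≤ v q

/-- A strategy: a history of past states together with the current state gives a
mixed action.  (This encodes maps `Q⁺ → 𝒟(X)`.) -/
def Strat (Q X : Type) [Fintype X] : Type := List Q → Q → FDist X

/-- Residual strategy after the history `π` has been played. -/
def residual {X : Type} [Fintype X] (s : Strat Q X) (π : List Q) : Strat Q X :=
  fun h q => s (π ++ h) q

/-- The (positional) strategy associated with a per-state choice of mixed actions. -/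
def ofPos {X : Type} [Fintype X] (s : Q → FDist X) : Strat Q X := fun _ q => s q

/-- Probability of reaching the set `S` within `n` steps from current state `q`,
history `h` having been played. -/
def reachSetNAux (δ : Q → A → B → D) (dist : D → FDist Q) (S : Set Q) :
    ℕ → Strat Q A → Strat Q B → List Q → Q → ℝ
  | 0, _, _, _, q => if q ∈ S then 1 else 0
  | n + 1, sA, sB, h, q =>
      if q ∈ S then 1
      else ∑ q', step δ dist (sA h q) (sB h q) q q' *
        reachSetNAux δ dist S n sA sB (h ++ [q]) q'

/-- Probability of reaching the set `S` within `n` steps from state `q`. -/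
def reachSetN (δ : Q → A → B → D) (dist : D → FDist Q) (S : Set Q) (n : ℕ)
    (sA : Strat Q A) (sB : Strat Q B) (q : Q) : ℝ :=
  reachSetNAux δ dist S n sA sB [] q

/-- Probability of reaching the target `T` within `n` steps from state `q`. -/
def reachN (δ : Q → A → B → D) (dist : D → FDist Q) (T : Q) (n : ℕ)
    (sA : Strat Q A) (sB : Strat Q B) (q : Q) : ℝ :=
  reachSetN δ dist {T} n sA sB q

/-- Probability of eventually reaching the target `T` from state `q`. -/
def reach (δ : Q → A → B → D) (dist : D → FDist Q) (T : Q)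
    (sA : Strat Q A) (sB : Strat Q B) (q : Q) : ℝ :=
  ⨆ n : ℕ, reachN δ dist T n sA sB q

/-- The value of a Player A strategy from state `q`. -/
def valA (δ : Q → A → B → D) (dist : D → FDist Q) (T : Q) (sA : Strat Q A) (q : Q) : ℝ :=
  ⨅ sB : Strat Q B, reach δ dist T sA sB q

/-- The value of the game from state `q`. -/
def value (δ : Q → A → B → D) (dist : D → FDist Q) (T : Q) (q : Q) : ℝ :=
  ⨆ sA : Strat Q A, valA δ dist T sA q

/-- A state is maximizable when Player A has an optimal strategy from it. -/
def Maximizable (δ : Q → A → B → D) (dist : D → FDist Q) (T q : Q) : Prop :=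
  ∃ sA : Strat Q A, valA δ dist T sA q = value δ dist T q

/-- A positional Player A strategy locally dominates the valuation `v`. -/
def LocallyDominates (δ : Q → A → B → D) (dist : D → FDist Q)
    (sA : Q → FDist A) (v : Q → ℝ) : Prop :=
  ∀ q, v q ≤ valStratGF (fun a b => lift dist v (δ q a b)) (sA q)

/-- Transition function ι of the MDP induced by a positional Player A strategy. -/
def stepB [DecidableEq B] (δ : Q → A → B → D) (dist : D → FDist Q)
    (sA : Q → FDist A) (q : Q) (b : B) (q' : Q) : ℝ :=
  step δ dist (sA q) (dirac b) q q'

/-- An end component of the MDP induced by the positional Player A strategy `sA`. -/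
structure EndComp [DecidableEq B] (δ : Q → A → B → D) (dist : D → FDist Q)
    (sA : Q → FDist A) where
  states : Set Q
  acts : Q → Set B
  acts_nonempty : ∀ q ∈ states, (acts q).Nonempty
  closed : ∀ q ∈ states, ∀ b ∈ acts q, ∀ q', stepB δ dist sA q b q' ≠ 0 → q' ∈ states
  connected : ∀ q ∈ states, ∀ q' ∈ states,
    Relation.ReflTransGen
      (fun x y => x ∈ states ∧ ∃ b ∈ acts x, stepB δ dist sA x b y ≠ 0) q q'

/-- `S_D` : the Nature states having a non-zero probability to reach `S`. -/
def natS (dist : D → FDist Q) (S : Set Q) : Set D :=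
  { d | ∃ q ∈ S, (dist d).1 q ≠ 0 }

/-- Progressive optimal local strategies at `q` w.r.t. the set `Gd`. -/
def Prog (δ : Q → A → B → D) (dist : D → FDist Q) (m : Q → ℝ) (q : Q)
    (Gd : Set Q) : Set (FDist A) :=
  { σA | σA ∈ OptA (locPay δ dist m q) ∧
      ∀ b ∈ optActs (locPay δ dist m q) σA, ∃ a ∈ supp σA, δ q a b ∈ natS dist Gd }

/-- Risky optimal local strategies at `q` w.r.t. the set `Bd`. -/
def Risk (δ : Q → A → B → D) (dist : D → FDist Q) (m : Q → ℝ) (q : Q)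
    (Bd : Set Q) : Set (FDist A) :=
  { σA | σA ∈ OptA (locPay δ dist m q) ∧
      ∃ b ∈ optActs (locPay δ dist m q) σA, ∃ a ∈ supp σA, δ q a b ∈ natS dist Bd }

/-- Efficient local strategies: progressive and not risky. -/
def Eff (δ : Q → A → B → D) (dist : D → FDist Q) (m : Q → ℝ) (q : Q)
    (Gd Bd : Set Q) : Set (FDist A) :=
  Prog δ dist m q Gd \ Risk δ dist m q Bd

/-- The increasing sequence of sets of secure states w.r.t. `Bd`. -/
def SecN (δ : Q → A → B → D) (dist : D → FDist Q) (m : Q → ℝ) (T : Q) (Bd : Set Q) :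
    ℕ → Set Q
  | 0 => {T}
  | n + 1 => SecN δ dist m T Bd n ∪
      { q | q ∉ Bd ∧ (Eff δ dist m q (SecN δ dist m T Bd n) Bd).Nonempty }

/-- The set of secure states w.r.t. `Bd`. -/
def Sec (δ : Q → A → B → D) (dist : D → FDist Q) (m : Q → ℝ) (T : Q) (Bd : Set Q) :
    Set Q :=
  (⋃ n : ℕ, SecN δ dist m T Bd n) ∪ { q | m q = 0 }

/-- The sequence of sets of bad states. -/
def BadN (δ : Q → A → B → D) (dist : D → FDist Q) (m : Q → ℝ) (T : Q) : ℕ → Set Q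
  | 0 => ∅
  | n + 1 => (Sec δ dist m T (BadN δ dist m T n))ᶜ

/-- The set of bad states. -/
def Bad (δ : Q → A → B → D) (dist : D → FDist Q) (m : Q → ℝ) (T : Q) : Set Q :=
  BadN δ dist m T (Fintype.card Q)

/-- `α[y]` : the total valuation extending the partial valuation `α : O∖E → [0,1]`
with the value `y` on `E`. -/
def extendVal {O : Type} (E : Set O) (α : O → ℝ) (y : ℝ) : O → ℝ :=
  fun o => if o ∈ E then y else α o

/-- The map `f_α : y ↦ val_{⟨F, α[y]⟩}`. -/
def fval {O : Type} (ρ : A → B → O) (E : Set O) (α : O → ℝ) (y : ℝ) : ℝ :=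
  valGF (fun a b => extendVal E α y (ρ a b))

/-- `v` is the least fixed point of `f_α` on `[0,1]`. -/
def IsLfpVal {O : Type} (ρ : A → B → O) (E : Set O) (α : O → ℝ) (v : ℝ) : Prop :=
  v ∈ Set.Icc (0:ℝ) 1 ∧ fval ρ E α v = v ∧
    ∀ y ∈ Set.Icc (0:ℝ) 1, fval ρ E α y = y → v ≤ y

/-- The game form `ρ` is reach-maximizable w.r.t. the partial valuation `α : O∖E → [0,1]`. -/
def RMwrt {O : Type} (ρ : A → B → O) (E : Set O) (α : O → ℝ) : Prop :=
  ∀ v : ℝ, IsLfpVal ρ E α v →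
    v = 0 ∨
      ∃ σA ∈ OptA (fun a b => extendVal E α v (ρ a b)),
        ∀ b ∈ optActs (fun a b => extendVal E α v (ρ a b)) σA,
          ∃ a ∈ supp σA, ρ a b ∉ E

/-- A reach-maximizable game form: RM w.r.t. every partial valuation of its outcomes. -/
def RMform {O : Type} (ρ : A → B → O) : Prop :=
  ∀ (E : Set O) (α : O → ℝ), (∀ o ∉ E, α o ∈ Set.Icc (0:ℝ) 1) → RMwrt ρ E α

/-- A determined game form. -/
def Determined {O : Type} (ρ : A → B → O) : Prop :=
  ∀ E : Set O, (∃ a, ∀ b, ρ a b ∈ E) ∨ (∃ b, ∀ a, ρ a b ∉ E)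

/-- Transition function of the three-state reachability game `C_{(F,α)}`:
state `0` is `q₀`, state `1` is the target `⊤`, state `2` is the bin `⊥`. -/
def triδ {O : Type} (ρ : A → B → O) (E : Set O) :
    Fin 3 → A → B → (Fin 3 ⊕ {o : O // o ∉ E}) :=
  fun s a b =>
    if s = 0 then
      if h : ρ a b ∈ E then Sum.inl 0 else Sum.inr ⟨ρ a b, h⟩
    else Sum.inl s

/-- Nature distributions of the three-state reachability game `C_{(F,α)}`. -/
def triDist {O : Type} (E : Set O) (α : O → ℝ)
    (hα : ∀ o ∉ E, α o ∈ Set.Icc (0:ℝ) 1) :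
    (Fin 3 ⊕ {o : O // o ∉ E}) → FDist (Fin 3) := fun d =>
  match d with
  | Sum.inl t => dirac t
  | Sum.inr x =>
      ⟨![0, α x.1, 1 - α x.1], by
        obtain ⟨h0, h1⟩ := hα x.1 x.2
        constructor
        · intro s
          fin_cases s <;> simp <;> linarith
        · simp [Fin.sum_univ_three]⟩

/-- An abstract (finite) game form with actions `A` and `B`. -/
structure GameForm (A B : Type) where
  O : Type
  fin : Fintype O
  ρ : A → B → O

/-- All local interactions of the arena `δ` belong to the set `𝒢` of game forms
(up to a renaming of the outcomes into Nature states). -/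
def UsesForms {Q D : Type} (𝒢 : Set (GameForm A B)) (δ : Q → A → B → D) : Prop :=
  ∀ q, ∃ F ∈ 𝒢, ∃ g : F.O → D, δ q = fun a b => g (F.ρ a b)

/-- The sequence of iterates of Δ starting from the valuation `1_{⊤}`. -/
def vseq (δ : Q → A → B → D) (dist : D → FDist Q) (T : Q) : ℕ → Q → ℝ
  | 0 => fun q => if q = T then 1 else 0
  | n + 1 => Δop δ dist T (vseq δ dist T n)

/-- Relevant paths w.r.t. the strategy `sA` from the state `q₀`: the pair `(h, q)`
encodes the path `h · q` (history `h`, current state `q`). -/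
inductive Relevant [DecidableEq B] (δ : Q → A → B → D) (dist : D → FDist Q)
    (m : Q → ℝ) (sA : Strat Q A) (q₀ : Q) : List Q → Q → Prop
  | base : Relevant δ dist m sA q₀ [] q₀
  | step {h : List Q} {q q' : Q} :
      Relevant δ dist m sA q₀ h q →
      (∃ b ∈ optActs (locPay δ dist m q) (sA h q),
        0 < CRG.step δ dist (sA h q) (dirac b) q q') →
      Relevant δ dist m sA q₀ (h ++ [q]) q'

end CRG

namespace CRG

section Helpers

variable {A B Q D : Type} [Fintype A] [Fintype B] [Fintype Q] [Fintype D]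

lemma aux_out_dirac (u : A → B → ℝ) (σ : FDist A) (b : B) :
    out u σ (dirac b) = outB u σ b := by
  unfold out outB dirac
  refine Finset.sum_congr rfl fun a _ => ?_
  simp

lemma aux_out_eq (u : A → B → ℝ) (σ : FDist A) (τ : FDist B) :
    out u σ τ = ∑ b, τ.1 b * outB u σ b := by
  unfold out outB
  rw [Finset.sum_comm]
  refine Finset.sum_congr rfl fun b _ => ?_
  rw [Finset.mul_sum]
  refine Finset.sum_congr rfl fun a _ => ?_
  ring

lemma aux_exists_opt [Nonempty B] (u : A → B → ℝ) (σ : FDist A) :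
    ∃ b, outB u σ b = valStratGF u σ ∧ ∀ b', valStratGF u σ ≤ outB u σ b' := by
  obtain ⟨b, hb⟩ := Finite.exists_min (fun b => outB u σ b)
  have hlow : ∀ τ : FDist B, outB u σ b ≤ out u σ τ := by
    intro τ
    rw [aux_out_eq]
    calc outB u σ b = ∑ b', τ.1 b' * outB u σ b := by
          rw [← Finset.sum_mul, τ.2.2, one_mul]
      _ ≤ _ := Finset.sum_le_sum fun b' _ => mul_le_mul_of_nonneg_left (hb b') (τ.2.1 b')
  have hbdd : BddBelow (Set.range fun τ : FDist B => out u σ τ) :=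
    ⟨outB u σ b, by rintro _ ⟨τ, rfl⟩; exact hlow τ⟩
  have : Nonempty (FDist B) := ⟨dirac b⟩
  have h1 : valStratGF u σ = outB u σ b := by
    apply le_antisymm
    · have := ciInf_le hbdd (dirac b)
      simp only [aux_out_dirac] at this
      exact this
    · exact le_ciInf hlow
  exact ⟨b, h1.symm, fun b' => h1 ▸ hb b'⟩

lemma aux_le_one (σ : FDist A) (a : A) : σ.1 a ≤ 1 := by
  refine le_trans ?_ σ.2.2.le
  exact Finset.single_le_sum (f := σ.1) (fun i _ => σ.2.1 i) (Finset.mem_univ a)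

lemma aux_bdd [Nonempty B] (u : A → B → ℝ) :
    BddAbove (Set.range fun σ : FDist A => valStratGF u σ) := by
  obtain ⟨b⟩ := ‹Nonempty B›
  have : Nonempty B := ⟨b⟩
  refine ⟨∑ a, |u a b|, ?_⟩
  rintro _ ⟨σ, rfl⟩
  obtain ⟨_, _, h⟩ := aux_exists_opt u σ
  refine (h b).trans (Finset.sum_le_sum fun a _ => ?_)
  calc σ.1 a * u a b ≤ σ.1 a * |u a b| :=
        mul_le_mul_of_nonneg_left (le_abs_self _) (σ.2.1 a)
    _ ≤ 1 * |u a b| := mul_le_mul_of_nonneg_right (aux_le_one σ a) (abs_nonneg _)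
    _ = _ := one_mul _

lemma aux_valStrat_le [Nonempty B] (u : A → B → ℝ) (σ : FDist A) :
    valStratGF u σ ≤ valGF u := le_ciSup (aux_bdd u) σ

lemma aux_outB_mono (u u' : A → B → ℝ) (c : ℝ) (h : ∀ a b, u a b ≤ u' a b + c) (σ : FDist A)
    (b : B) : outB u σ b ≤ outB u' σ b + c := by
  unfold outB
  calc ∑ a, σ.1 a * u a b ≤ ∑ a, σ.1 a * (u' a b + c) :=
        Finset.sum_le_sum fun a _ => mul_le_mul_of_nonneg_left (h a b) (σ.2.1 a)
    _ = _ := by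
        simp only [mul_add, Finset.sum_add_distrib]
        rw [← Finset.sum_mul, σ.2.2, one_mul]

lemma aux_val_mono [Nonempty A] [Nonempty B] (u u' : A → B → ℝ) (c : ℝ)
    (h : ∀ a b, u a b ≤ u' a b + c) : valGF u ≤ valGF u' + c := by
  have : Nonempty (FDist A) := ⟨dirac (Classical.arbitrary A)⟩
  refine ciSup_le fun σ => ?_
  obtain ⟨b, hb, _⟩ := aux_exists_opt u' σ
  obtain ⟨_, _, h2⟩ := aux_exists_opt u σ
  have h3 := aux_outB_mono u u' c h σ b
  have h4 := aux_valStrat_le u' σ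
  linarith [h2 b]

lemma aux_val_mem [Nonempty A] [Nonempty B] (u : A → B → ℝ)
    (h : ∀ a b, u a b ∈ Set.Icc (0:ℝ) 1) : valGF u ∈ Set.Icc (0:ℝ) 1 := by
  have key : ∀ σ : FDist A, valStratGF u σ ∈ Set.Icc (0:ℝ) 1 := by
    intro σ
    obtain ⟨b, hb, _⟩ := aux_exists_opt u σ
    rw [← hb]
    unfold outB
    constructor
    · exact Finset.sum_nonneg fun a _ => mul_nonneg (σ.2.1 a) (h a b).1
    · refine le_trans ?_ σ.2.2.le
      refine Finset.sum_le_sum fun a _ => ?_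
      have := mul_le_mul_of_nonneg_left (h a b).2 (σ.2.1 a)
      linarith
  have : Nonempty (FDist A) := ⟨dirac (Classical.arbitrary A)⟩
  exact ⟨(key (Classical.arbitrary _)).1.trans (aux_valStrat_le u _),
    ciSup_le fun σ => (key σ).2⟩

lemma aux_lift_mono (dist : D → FDist Q) {v w : Q → ℝ} (h : ∀ q, v q ≤ w q) (d : D) :
    lift dist v d ≤ lift dist w d :=
  Finset.sum_le_sum fun q _ => mul_le_mul_of_nonneg_left (h q) ((dist d).2.1 q)

lemma aux_lift_mem (dist : D → FDist Q) {v : Q → ℝ} (h : ∀ q, v q ∈ Set.Icc (0:ℝ) 1) (d : D) :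
    lift dist v d ∈ Set.Icc (0:ℝ) 1 := by
  unfold lift
  constructor
  · exact Finset.sum_nonneg fun q _ => mul_nonneg ((dist d).2.1 q) (h q).1
  · refine le_trans ?_ (dist d).2.2.le
    refine Finset.sum_le_sum fun q _ => ?_
    have := mul_le_mul_of_nonneg_left (h q).2 ((dist d).2.1 q)
    linarith

lemma aux_Δ_mono [Nonempty A] [Nonempty B] (δ : Q → A → B → D) (dist : D → FDist Q) (T : Q)
    {v w : Q → ℝ} (h : ∀ q, v q ≤ w q) (q : Q) : Δop δ dist T v q ≤ Δop δ dist T w q := by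
  unfold Δop
  split
  · exact le_rfl
  · have := aux_val_mono (fun a b => lift dist v (δ q a b)) (fun a b => lift dist w (δ q a b)) 0
      (fun a b => by simpa using aux_lift_mono dist h (δ q a b))
    simpa using this

lemma aux_Δ_mem [Nonempty A] [Nonempty B] (δ : Q → A → B → D) (dist : D → FDist Q) (T : Q)
    {v : Q → ℝ} (h : ∀ q, v q ∈ Set.Icc (0:ℝ) 1) (q : Q) :
    Δop δ dist T v q ∈ Set.Icc (0:ℝ) 1 := by
  unfold Δop
  split
  · simp
  · exact aux_val_mem _ fun a b => aux_lift_mem dist h _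

/-- Existence of the least (pre-)fixed point of `Δ`. -/
lemma aux_lfp [Nonempty A] [Nonempty B] (δ : Q → A → B → D) (dist : D → FDist Q) (T : Q) :
    ∃ m : Q → ℝ, (∀ q, m q ∈ Set.Icc (0:ℝ) 1) ∧ (∀ q, Δop δ dist T m q = m q) ∧
      ∀ v : Q → ℝ, (∀ q, v q ∈ Set.Icc (0:ℝ) 1) → (∀ q, Δop δ dist T v q ≤ v q) →
        ∀ q, m q ≤ v q := by
  let P : Set (Q → ℝ) := {v | (∀ q, v q ∈ Set.Icc (0:ℝ) 1) ∧ ∀ q, Δop δ dist T v q ≤ v q}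
  have h1 : (fun _ => 1 : Q → ℝ) ∈ P :=
    ⟨fun _ => by simp, fun q => (aux_Δ_mem δ dist T (v := fun _ => 1) (fun _ => by simp) q).2⟩
  have : Nonempty P := ⟨⟨_, h1⟩⟩
  have hb : ∀ q, BddBelow (Set.range fun v : P => v.1 q) := fun q =>
    ⟨0, by rintro _ ⟨v, rfl⟩; exact (v.2.1 q).1⟩
  let m : Q → ℝ := fun q => ⨅ v : P, v.1 q
  have hle : ∀ v (hv : v ∈ P) q, m q ≤ v q := fun v hv q => ciInf_le (hb q) ⟨v, hv⟩
  have hm : ∀ q, m q ∈ Set.Icc (0:ℝ) 1 := fun q =>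
    ⟨le_ciInf fun v => (v.2.1 q).1, hle _ h1 q⟩
  have hpre : ∀ q, Δop δ dist T m q ≤ m q := fun q =>
    le_ciInf fun v => (aux_Δ_mono δ dist T (hle v.1 v.2) q).trans (v.2.2 q)
  refine ⟨m, hm, fun q => le_antisymm (hpre q) ?_, fun v h h' q => hle v ⟨h, h'⟩ q⟩
  exact hle _ ⟨aux_Δ_mem δ dist T hm, aux_Δ_mono δ dist T hpre⟩ q

lemma aux_step_sum (δ : Q → A → B → D) (dist : D → FDist Q) (σ : FDist A) (τ : FDist B)
    (q : Q) (v : Q → ℝ) :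
    ∑ q', step δ dist σ τ q q' * v q' = out (locPay δ dist v q) σ τ := by
  unfold step out locPay lift
  simp only [Finset.sum_mul, Finset.mul_sum]
  rw [Finset.sum_comm]
  refine Finset.sum_congr rfl fun a _ => ?_
  rw [Finset.sum_comm]
  refine Finset.sum_congr rfl fun b _ => Finset.sum_congr rfl fun q' _ => ?_
  ring

lemma aux_step_nonneg (δ : Q → A → B → D) (dist : D → FDist Q) (σ : FDist A) (τ : FDist B)
    (q q' : Q) : 0 ≤ step δ dist σ τ q q' :=
  Finset.sum_nonneg fun a _ => Finset.sum_nonneg fun b _ =>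
    mul_nonneg (mul_nonneg (σ.2.1 a) (τ.2.1 b)) ((dist _).2.1 q')

lemma aux_step_one (δ : Q → A → B → D) (dist : D → FDist Q) (σ : FDist A) (τ : FDist B)
    (q : Q) : ∑ q', step δ dist σ τ q q' = 1 := by
  have := aux_step_sum δ dist σ τ q (fun _ => 1)
  simp only [mul_one] at this
  rw [this, aux_out_eq]
  have h : ∀ b, outB (locPay δ dist (fun _ => (1:ℝ)) q) σ b = 1 := by
    intro b
    unfold outB locPay lift
    simp only [mul_one, (dist _).2.2, σ.2.2]
  simp only [h, mul_one, τ.2.2]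

lemma aux_reach_mem (δ : Q → A → B → D) (dist : D → FDist Q) (S : Set Q)
    (sA : Strat Q A) (sB : Strat Q B) (n : ℕ) : ∀ (h : List Q) (q : Q),
    reachSetNAux δ dist S n sA sB h q ∈ Set.Icc (0:ℝ) 1 := by
  induction n with
  | zero => intro h q; unfold reachSetNAux; split <;> simp
  | succ n ih =>
    intro h q
    unfold reachSetNAux
    split
    · simp
    · constructor
      · exact Finset.sum_nonneg fun q' _ => mul_nonneg (aux_step_nonneg ..) (ih _ _).1
      · rw [← aux_step_one δ dist (sA h q) (sB h q) q]
        refine Finset.sum_le_sum fun q' _ => ?_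
        have := mul_le_mul_of_nonneg_left (ih (h ++ [q]) q').2
          (aux_step_nonneg δ dist (sA h q) (sB h q) q q')
        linarith

lemma aux_reach_bdd (δ : Q → A → B → D) (dist : D → FDist Q) (T : Q)
    (sA : Strat Q A) (sB : Strat Q B) (q : Q) :
    BddAbove (Set.range fun n => reachN δ dist T n sA sB q) :=
  ⟨1, by rintro _ ⟨n, rfl⟩; exact (aux_reach_mem δ dist {T} sA sB n [] q).2⟩

/-- No Player A strategy does better than the fixed point `m`. -/
lemma aux_upper [Nonempty A] [Nonempty B] (δ : Q → A → B → D) (dist : D → FDist Q) (T : Q)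
    (m : Q → ℝ) (hm : ∀ q, m q ∈ Set.Icc (0:ℝ) 1) (hfix : ∀ q, Δop δ dist T m q = m q)
    (sA : Strat Q A) (q : Q) : valA δ dist T sA q ≤ m q := by
  have hex : ∀ h q, ∃ b, outB (locPay δ dist m q) (sA h q) b
      = valStratGF (locPay δ dist m q) (sA h q) := fun h q =>
    (aux_exists_opt _ _).imp fun b hb => hb.1
  choose β hβ using hex
  let sB : Strat Q B := fun h q => dirac (β h q)
  have key : ∀ n h q, reachSetNAux δ dist {T} n sA sB h q ≤ m q := by
    intro n
    have hT : m T = 1 := by rw [← hfix T]; simp [Δop]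
    induction n with
    | zero =>
      intro h q
      unfold reachSetNAux
      split
      · next hq => rw [Set.mem_singleton_iff.1 hq, hT]
      · exact (hm q).1
    | succ n ih =>
      intro h q
      unfold reachSetNAux
      split
      · next hq => rw [Set.mem_singleton_iff.1 hq, hT]
      · next hq =>
        have hq' : q ≠ T := hq
        calc _ ≤ ∑ q', step δ dist (sA h q) (sB h q) q q' * m q' :=
              Finset.sum_le_sum fun q' _ =>
                mul_le_mul_of_nonneg_left (ih _ _) (aux_step_nonneg ..)
          _ = outB (locPay δ dist m q) (sA h q) (β h q) := by
              rw [aux_step_sum, aux_out_dirac]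
          _ ≤ valGF (locPay δ dist m q) := by
              rw [hβ]; exact aux_valStrat_le _ _
          _ = m q := by
              have := hfix q
              simp only [Δop, hq', if_false] at this
              exact this
  have hb : BddBelow (Set.range fun sB : Strat Q B => reach δ dist T sA sB q) :=
    ⟨0, by
      rintro _ ⟨sB, rfl⟩
      exact (aux_reach_mem δ dist {T} sA sB 0 [] q).1.trans
        (le_ciSup (aux_reach_bdd δ dist T sA sB q) 0)⟩
  exact (ciInf_le hb sB).trans (ciSup_le fun n => key n [] q)

/-- Worst-case `n`-step reachability value of a positional strategy. -/
def wseq (δ : Q → A → B → D) (dist : D → FDist Q) (T : Q) (s : Q → FDist A) : ℕ → Q → ℝ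
  | 0 => fun q => if q = T then 1 else 0
  | n + 1 => fun q => if q = T then 1 else valStratGF (B := B) (locPay δ dist (wseq δ dist T s n) q) (s q)

lemma aux_wseq_le [Nonempty B] (δ : Q → A → B → D) (dist : D → FDist Q) (T : Q) (s : Q → FDist A)
    (sB : Strat Q B) (n : ℕ) : ∀ h q,
    wseq δ dist T s n q ≤ reachSetNAux δ dist {T} n (ofPos s) sB h q := by
  induction n with
  | zero => intro h q; simp [wseq, reachSetNAux]
  | succ n ih =>
    intro h q
    unfold wseq reachSetNAux
    by_cases hq : q = T
    · simp [hq]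
    · simp only [hq, if_false, Set.mem_singleton_iff]
      have h1 : valStratGF (locPay δ dist (wseq δ dist T s n) q) (s q) ≤
          out (locPay δ dist (wseq δ dist T s n) q) (s q) (sB h q) := by
        rw [aux_out_eq]
        obtain ⟨_, _, h2⟩ := aux_exists_opt (locPay δ dist (wseq δ dist T s n) q) (s q)
        calc _ = ∑ b, (sB h q).1 b * valStratGF (locPay δ dist (wseq δ dist T s n) q) (s q) := by
              rw [← Finset.sum_mul, (sB h q).2.2, one_mul]
          _ ≤ _ := Finset.sum_le_sum fun b _ => mul_le_mul_of_nonneg_left (h2 b) ((sB h q).2.1 b)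
      refine h1.trans ?_
      rw [← aux_step_sum]
      exact Finset.sum_le_sum fun q' _ =>
        mul_le_mul_of_nonneg_left (ih _ _) (aux_step_nonneg ..)

lemma aux_wseq_zero_le [Nonempty B] (δ : Q → A → B → D) (dist : D → FDist Q) (T : Q)
    (s : Q → FDist A) (n : ℕ) : ∀ q, 0 ≤ wseq δ dist T s n q := by
  induction n with
  | zero => intro q; unfold wseq; split <;> simp
  | succ n ih =>
    intro q
    unfold wseq
    split
    · simp
    · obtain ⟨b, hb, _⟩ := aux_exists_opt (locPay δ dist (wseq δ dist T s n) q) (s q)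
      rw [← hb]
      exact Finset.sum_nonneg fun a _ => mul_nonneg ((s q).2.1 a)
        (Finset.sum_nonneg fun q' _ => mul_nonneg ((dist _).2.1 q') (ih q'))

lemma aux_wseq_mono [Nonempty B] (δ : Q → A → B → D) (dist : D → FDist Q) (T : Q)
    (s : Q → FDist A) (n : ℕ) : ∀ q, wseq δ dist T s n q ≤ wseq δ dist T s (n + 1) q := by
  induction n with
  | zero =>
    intro q
    have := aux_wseq_zero_le δ dist T s 1 q
    by_cases hq : q = T
    · simp [wseq, hq]
    · simpa [wseq, hq] using this
  | succ n ih =>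
    intro q
    by_cases hq : q = T
    · simp [wseq, hq]
    · rw [wseq, wseq]
      simp only [hq, if_false]
      obtain ⟨b, hb, _⟩ := aux_exists_opt (locPay δ dist (wseq δ dist T s (n + 1)) q) (s q)
      obtain ⟨_, _, h2⟩ := aux_exists_opt (locPay δ dist (wseq δ dist T s n) q) (s q)
      rw [← hb]
      refine (h2 b).trans ?_
      have := aux_outB_mono (locPay δ dist (wseq δ dist T s n) q)
        (locPay δ dist (wseq δ dist T s (n + 1)) q) 0
        (fun a b => by simpa [locPay] using aux_lift_mono dist ih (δ q a b)) (s q) b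
      simpa using this

lemma aux_wseq_le_one [Nonempty B] (δ : Q → A → B → D) (dist : D → FDist Q) (T : Q)
    (s : Q → FDist A) (n : ℕ) (q : Q) : wseq δ dist T s n q ≤ 1 :=
  (aux_wseq_le δ dist T s (fun _ _ => dirac (Classical.arbitrary B)) n [] q).trans
    (aux_reach_mem δ dist {T} _ _ n [] q).2

/-- The limit of `wseq`. -/
lemma aux_wlim [Nonempty B] (δ : Q → A → B → D) (dist : D → FDist Q) (T : Q)
    (s : Q → FDist A) : ∃ w : Q → ℝ, (∀ q, 0 ≤ w q) ∧ w T = 1 ∧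
      (∀ q, w q ≤ valA δ dist T (ofPos s) q) ∧
      ∀ q, q ≠ T → ∃ b, outB (locPay δ dist w q) (s q) b ≤ w q := by
  have hbd : ∀ q, BddAbove (Set.range fun n => wseq δ dist T s n q) := fun q =>
    ⟨1, by rintro _ ⟨n, rfl⟩; exact aux_wseq_le_one δ dist T s n q⟩
  have hlim : ∀ q, Filter.Tendsto (fun n => wseq δ dist T s n q) Filter.atTop
      (nhds (⨆ n, wseq δ dist T s n q)) := fun q =>
    tendsto_atTop_ciSup (monotone_nat_of_le_succ fun n => aux_wseq_mono δ dist T s n q) (hbd q)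
  let w : Q → ℝ := fun q => ⨆ n, wseq δ dist T s n q
  have hwn : ∀ n q, wseq δ dist T s n q ≤ w q := fun n q => le_ciSup (hbd q) n
  have : Nonempty (Strat Q B) := ⟨fun _ _ => dirac (Classical.arbitrary B)⟩
  refine ⟨w, fun q => (aux_wseq_zero_le δ dist T s 0 q).trans (hwn 0 q), ?_, ?_, ?_⟩
  · apply le_antisymm
    · exact ciSup_le fun n => aux_wseq_le_one δ dist T s n T
    · have := hwn 0 T
      simpa [wseq] using this
  · intro q
    refine le_ciInf fun sB => ciSup_le fun n => ?_
    exact (aux_wseq_le δ dist T s sB n [] q).trans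
      (le_ciSup (aux_reach_bdd δ dist T (ofPos s) sB q) n)
  · intro q hq
    by_contra hcon
    push Not at hcon
    have hev : ∀ b, ∀ᶠ n in Filter.atTop,
        w q < outB (locPay δ dist (wseq δ dist T s n) q) (s q) b := by
      intro b
      have ht : Filter.Tendsto (fun n => outB (locPay δ dist (wseq δ dist T s n) q) (s q) b)
          Filter.atTop (nhds (outB (locPay δ dist w q) (s q) b)) := by
        unfold outB locPay lift
        refine tendsto_finsetSum _ fun a _ => Filter.Tendsto.const_mul _ ?_
        exact tendsto_finsetSum _ fun q' _ => Filter.Tendsto.const_mul _ (hlim q')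
      exact ht.eventually (lt_mem_nhds (hcon b))
    obtain ⟨n, hn⟩ := (Filter.eventually_all.2 hev).exists
    obtain ⟨b, hb, _⟩ := aux_exists_opt (locPay δ dist (wseq δ dist T s n) q) (s q)
    have h1 := hn b
    have h2 := hwn (n + 1) q
    rw [wseq] at h2
    simp only [hq, if_false] at h2
    linarith

/-- States from which Player A can progress towards the target. -/
def Prg (δ : Q → A → B → D) (dist : D → FDist Q) (m : Q → ℝ) (T : Q) : ℕ → Set Q
  | 0 => {T}
  | n + 1 => Prg δ dist m T n ∪ { q | (Prog δ dist m q (Prg δ dist m T n)).Nonempty }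

lemma aux_Prg_mono (δ : Q → A → B → D) (dist : D → FDist Q) (m : Q → ℝ) (T : Q) :
    Monotone (Prg δ dist m T) :=
  monotone_nat_of_le_succ fun n => by
    intro q hq
    rw [Prg]
    exact Or.inl hq

/-- If every state of positive value is progressive, then some positional strategy is optimal. -/
lemma aux_lower [Nonempty A] [Nonempty B] (δ : Q → A → B → D) (dist : D → FDist Q) (T : Q)
    (m : Q → ℝ) (hm : ∀ q, m q ∈ Set.Icc (0:ℝ) 1) (hfix : ∀ q, Δop δ dist T m q = m q)
    (hP : ∀ q, 0 < m q → ∃ n, q ∈ Prg δ dist m T n) :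
    ∃ s : Q → FDist A, ∀ q, m q ≤ valA δ dist T (ofPos s) q := by
  have hσ : ∀ q, ∃ σ : FDist A, ∀ n, q ∉ Prg δ dist m T n → q ∈ Prg δ dist m T (n + 1) →
      σ ∈ Prog δ dist m q (Prg δ dist m T n) := by
    intro q
    by_cases hq : ∃ n, q ∉ Prg δ dist m T n ∧ q ∈ Prg δ dist m T (n + 1)
    · obtain ⟨n, hn, hn'⟩ := hq
      rw [Prg] at hn'
      rcases hn' with h | ⟨σ, hσ⟩
      · exact absurd h hn
      · refine ⟨σ, fun k hk hk' => ?_⟩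
        have : k = n := by
          rcases lt_trichotomy k n with h | h | h
          · exact absurd (aux_Prg_mono δ dist m T (Nat.succ_le_of_lt h) hk') hn
          · exact h
          · refine absurd (aux_Prg_mono δ dist m T (Nat.succ_le_of_lt h) ?_) hk
            rw [Prg]
            exact Or.inr ⟨σ, hσ⟩
        rw [this]
        exact hσ
    · push Not at hq
      exact ⟨dirac (Classical.arbitrary A), fun n h h' => absurd h' (hq n h)⟩
  choose s hs using hσ
  refine ⟨s, ?_⟩
  obtain ⟨w, hw0, hwT, hwval, hwb⟩ := aux_wlim δ dist T s
  suffices hmw : ∀ q, m q ≤ w q from fun q => (hmw q).trans (hwval q)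
  have : Nonempty Q := ⟨T⟩
  obtain ⟨q₀, hq₀⟩ := Finite.exists_max (fun q => m q - w q)
  by_contra hcon
  push Not at hcon
  obtain ⟨q₁, hq₁⟩ := hcon
  have hc : 0 < m q₀ - w q₀ := lt_of_lt_of_le (by linarith) (hq₀ q₁)
  set c := m q₀ - w q₀ with hcdef
  have hpos : ∀ q, m q - w q = c → 0 < m q := fun q hq => by linarith [hw0 q]
  have hex : ∃ n q, m q - w q = c ∧ q ∈ Prg δ dist m T n := by
    obtain ⟨n, hn⟩ := hP q₀ (hpos q₀ rfl)
    exact ⟨n, q₀, rfl, hn⟩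
  obtain ⟨q, hqc, hqn⟩ := Nat.find_spec hex
  have hmin : ∀ k, k < Nat.find hex → ∀ q', m q' - w q' = c → q' ∉ Prg δ dist m T k :=
    fun k hk q' h1 h2 => Nat.find_min hex hk ⟨q', h1, h2⟩
  have hqT : q ≠ T := by
    rintro rfl
    linarith [(hm q).2]
  cases hN : Nat.find hex with
  | zero =>
    rw [hN] at hqn
    exact hqT hqn
  | succ n =>
    rw [hN] at hqn
    have hmin' := hmin n (by omega)
    have hpr := hs q n (hmin' q hqc) hqn
    obtain ⟨hopt, hprog⟩ := hpr
    have hval : valStratGF (locPay δ dist m q) (s q) = m q := by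
      have h1 := hfix q
      simp only [Δop, hqT, if_false] at h1
      exact Eq.trans hopt h1
    obtain ⟨b, hb⟩ := hwb q hqT
    obtain ⟨_, _, hall⟩ := aux_exists_opt (locPay δ dist m q) (s q)
    have hmb := hall b
    rw [hval] at hmb
    -- the excess of each action is at most c
    have hdiff : ∀ d, lift dist m d - lift dist w d =
        ∑ q', (dist d).1 q' * (m q' - w q') := by
      intro d
      simp only [lift, mul_sub, Finset.sum_sub_distrib]
    have hdle : ∀ d, lift dist m d - lift dist w d ≤ c := by
      intro d
      rw [hdiff]
      calc _ ≤ ∑ q', (dist d).1 q' * c := Finset.sum_le_sum fun q' _ =>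
            mul_le_mul_of_nonneg_left (hq₀ q') ((dist d).2.1 q')
        _ = c := by rw [← Finset.sum_mul, (dist d).2.2, one_mul]
    have hsum : ∑ a, (s q).1 a * (c - (lift dist m (δ q a b) - lift dist w (δ q a b)))
        = c - (outB (locPay δ dist m q) (s q) b - outB (locPay δ dist w q) (s q) b) := by
      simp only [outB, locPay, mul_sub, Finset.sum_sub_distrib]
      rw [← Finset.sum_mul, (s q).2.2, one_mul]
    have hnn : ∀ a ∈ Finset.univ,
        0 ≤ (s q).1 a * (c - (lift dist m (δ q a b) - lift dist w (δ q a b))) :=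
      fun a _ => mul_nonneg ((s q).2.1 a) (by linarith [hdle (δ q a b)])
    have hge := Finset.sum_nonneg hnn
    have hmeq : outB (locPay δ dist m q) (s q) b = m q := by linarith
    have hzero : ∑ a, (s q).1 a * (c - (lift dist m (δ q a b) - lift dist w (δ q a b))) = 0 := by
      linarith
    obtain ⟨a, ha, q', hq', hdq'⟩ := hprog b (by
      show outB (locPay δ dist m q) (s q) b = _
      rw [hmeq, hval])
    have h1 := (Finset.sum_eq_zero_iff_of_nonneg hnn).1 hzero a (Finset.mem_univ a)
    have h2 : c - (lift dist m (δ q a b) - lift dist w (δ q a b)) = 0 :=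
      (mul_eq_zero.1 h1).resolve_left ha
    have h3 : ∑ x, (dist (δ q a b)).1 x * (c - (m x - w x)) = 0 := by
      refine Eq.trans ?_ h2
      rw [hdiff]
      simp only [mul_sub, Finset.sum_sub_distrib]
      rw [← Finset.sum_mul, (dist _).2.2, one_mul]
    have h4 := (Finset.sum_eq_zero_iff_of_nonneg (fun x _ =>
      mul_nonneg ((dist (δ q a b)).2.1 x) (by linarith [hq₀ x]))).1 h3 q' (Finset.mem_univ q')
    have h5 := (mul_eq_zero.1 h4).resolve_left hdq'
    exact hmin' q' (by linarith) hq'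

/-- With reach-maximizable local interactions, every state of positive value is progressive. -/
lemma aux_prog [Nonempty A] [Nonempty B] (δ : Q → A → B → D) (dist : D → FDist Q) (T : Q)
    (hRM : ∀ q : Q, RMform (δ q))
    (m : Q → ℝ) (hm : ∀ q, m q ∈ Set.Icc (0:ℝ) 1) (hfix : ∀ q, Δop δ dist T m q = m q)
    (hleast : ∀ v : Q → ℝ, (∀ q, v q ∈ Set.Icc (0:ℝ) 1) → (∀ q, Δop δ dist T v q ≤ v q) →
        ∀ q, m q ≤ v q) :
    ∀ q, 0 < m q → ∃ n, q ∈ Prg δ dist m T n := by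
  by_contra hcon
  push Not at hcon
  obtain ⟨q₁, hq₁, hq₁'⟩ := hcon
  obtain ⟨N, hN⟩ : ∃ N, ∀ n, Prg δ dist m T n ⊆ Prg δ dist m T N := by
    obtain ⟨N, hN⟩ := WellFoundedGT.monotone_chain_condition
      (⟨Prg δ dist m T, aux_Prg_mono δ dist m T⟩ : ℕ →o Set Q)
    refine ⟨N, fun n => ?_⟩
    rcases le_total N n with h | h
    · exact (hN n h).ge
    · exact aux_Prg_mono δ dist m T h
  set S := Prg δ dist m T N with hS
  -- a state of maximal value outside `S`
  obtain ⟨q₂, hq₂S, hq₂⟩ := Set.exists_max_image Sᶜ m (Set.toFinite _) ⟨q₁, hq₁' N⟩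
  set x := m q₂ with hx
  have hx0 : 0 < x := lt_of_lt_of_le hq₁ (hq₂ q₁ (hq₁' N))
  let R : Set Q := {q | q ∉ S ∧ m q = x}
  have hTS : T ∈ S := aux_Prg_mono δ dist m T (Nat.zero_le N) (rfl : T = T)
  have hRT : ∀ q ∈ R, q ≠ T := fun q hq h => hq.1 (h ▸ hTS)
  let E : Set D := {d | ∀ q, (dist d).1 q ≠ 0 → q ∈ R}
  have hE : ∀ d ∈ E, ∀ (v : Q → ℝ) (y : ℝ), (∀ q ∈ R, v q = y) → lift dist v d = y := by
    intro d hd v y hv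
    unfold lift
    have hy1 : ∑ q, (dist d).1 q * y = y := by rw [← Finset.sum_mul, (dist d).2.2, one_mul]
    refine Eq.trans ?_ hy1
    refine Finset.sum_congr rfl fun q _ => ?_
    by_cases h0 : (dist d).1 q = 0
    · simp [h0]
    · rw [hv q (hd q h0)]
  have hext : extendVal E (lift dist m) x = lift dist m := by
    funext d
    unfold extendVal
    split
    · next hd => exact (hE d hd m x fun q hq => hq.2).symm
    · rfl
  have hvalR : ∀ q ∈ R, valGF (fun a b => lift dist m (δ q a b)) = x := by
    intro q hq
    have := hfix q
    simp only [Δop, hRT q hq, if_false] at this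
    rw [← hq.2]
    exact this
  -- some state of R has x as least fixed point
  have hlfp : ∃ q ∈ R, IsLfpVal (δ q) E (lift dist m) x := by
    by_contra hno
    push Not at hno
    have hy : ∀ q ∈ R, ∃ y ∈ Set.Icc (0:ℝ) 1, fval (δ q) E (lift dist m) y = y ∧ y < x := by
      intro q hq
      by_contra hh
      push Not at hh
      refine hno q hq ⟨hm q₂, ?_, hh⟩
      unfold fval
      rw [hext]
      exact hvalR q hq
    choose! Y hY1 hY2 hY3 using hy
    obtain ⟨q₃, hq₃, hq₃max⟩ := Set.exists_max_image R Y (Set.toFinite _) ⟨q₂, hq₂S, rfl⟩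
    let w : Q → ℝ := fun q => if q ∈ R then Y q₃ else m q
    have hwR : ∀ q ∈ R, w q = Y q₃ := fun q hq => if_pos hq
    have hwm : ∀ q, w q ≤ m q := by
      intro q
      by_cases hq : q ∈ R
      · rw [hwR q hq, hq.2]
        exact (hY3 q₃ hq₃).le
      · exact (if_neg hq).le
    have hw01 : ∀ q, w q ∈ Set.Icc (0:ℝ) 1 := by
      intro q
      by_cases hq : q ∈ R
      · rw [hwR q hq]; exact hY1 q₃ hq₃
      · rw [show w q = m q from if_neg hq]; exact hm q
    have hpre : ∀ q, Δop δ dist T w q ≤ w q := by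
      intro q
      by_cases hq : q ∈ R
      · rw [hwR q hq]
        simp only [Δop, hRT q hq, if_false]
        have h1 := aux_val_mono (fun a b => lift dist w (δ q a b))
          (fun a b => extendVal E (lift dist m) (Y q) (δ q a b)) (Y q₃ - Y q) (by
            intro a b
            have hle := hq₃max q hq
            simp only [extendVal]
            split
            · next hd => rw [hE _ hd w _ hwR]; linarith
            · have := aux_lift_mono dist hwm (δ q a b)
              linarith)
        have h2 := hY2 q hq
        unfold fval at h2
        linarith
      · rw [show w q = m q from if_neg hq, ← hfix q]
        refine (aux_Δ_mono δ dist T hwm q).trans (le_of_eq ?_)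
        rfl
    have := hleast w hw01 hpre q₃
    rw [hwR q₃ hq₃, hq₃.2] at this
    linarith [hY3 q₃ hq₃]
  obtain ⟨q, hqR, hq⟩ := hlfp
  rcases hRM q E (lift dist m) (fun d _ => aux_lift_mem dist hm d) x hq with h | ⟨σ, hσ, hprog⟩
  · exact hx0.ne' h
  · rw [hext] at hσ hprog
    have hval : valStratGF (fun a b => lift dist m (δ q a b)) σ = x := by
      rw [show valStratGF (fun a b => lift dist m (δ q a b)) σ = _ from hσ]
      exact hvalR q hqR
    apply hqR.1
    apply hN (N + 1)
    rw [Prg]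
    refine Or.inr ⟨σ, hσ, fun b hb => ?_⟩
    obtain ⟨a, ha, hna⟩ := hprog b hb
    have hb' : outB (fun a b => lift dist m (δ q a b)) σ b = x := by rw [← hval]; exact hb
    by_contra hnone
    push Not at hnone
    have hsupp : ∀ a ∈ supp σ, ∀ q', (dist (δ q a b)).1 q' ≠ 0 → q' ∉ S :=
      fun a ha q' h1 h2 => hnone a ha ⟨q', h2, h1⟩
    have hd : ∀ d, x - lift dist m d = ∑ q', (dist d).1 q' * (x - m q') := by
      intro d
      simp only [lift, mul_sub, Finset.sum_sub_distrib]
      rw [← Finset.sum_mul, (dist d).2.2, one_mul]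
    have hterm : ∀ a ∈ supp σ, ∀ q', 0 ≤ (dist (δ q a b)).1 q' * (x - m q') := by
      intro a ha q'
      by_cases h0 : (dist (δ q a b)).1 q' = 0
      · simp [h0]
      · exact mul_nonneg ((dist _).2.1 q') (by linarith [hq₂ q' (hsupp a ha q' h0)])
    have hnn : ∀ a ∈ Finset.univ, 0 ≤ σ.1 a * (x - lift dist m (δ q a b)) := by
      intro a _
      by_cases h0 : σ.1 a = 0
      · simp [h0]
      · refine mul_nonneg (σ.2.1 a) ?_
        rw [hd]
        exact Finset.sum_nonneg fun q' _ => hterm a h0 q'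
    have hsum : ∑ a, σ.1 a * (x - lift dist m (δ q a b)) = 0 := by
      have : ∑ a, σ.1 a * (x - lift dist m (δ q a b)) =
          x - outB (fun a b => lift dist m (δ q a b)) σ b := by
        simp only [outB, mul_sub, Finset.sum_sub_distrib]
        rw [← Finset.sum_mul, σ.2.2, one_mul]
      rw [this, hb', sub_self]
    have h1 := (Finset.sum_eq_zero_iff_of_nonneg hnn).1 hsum a (Finset.mem_univ a)
    have h2 := (mul_eq_zero.1 h1).resolve_left ha
    rw [hd] at h2
    apply hna
    intro q' hq'
    have h3 := (Finset.sum_eq_zero_iff_of_nonneg (fun q' _ => hterm a ha q')).1 h2 q'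
      (Finset.mem_univ q')
    have h4 := (mul_eq_zero.1 h3).resolve_left hq'
    exact ⟨hsupp a ha q' hq', by linarith⟩

end Helpers

end CRG

/-- if all local interactions of a finite concurrent reachability game are
reach-maximizable game forms, then all states are maximizable. -/
theorem stmt9
    {A B Q D : Type} [Fintype A] [Fintype B] [Fintype Q] [Fintype D]
    [Nonempty A] [Nonempty B] [Nonempty Q] [Nonempty D] [DecidableEq Q]
    (δ : Q → A → B → D) (dist : D → FDist Q) (T : Q)
    (habs : CRG.Absorbing δ dist T)
    (hRM : ∀ q : Q, CRG.RMform (δ q)) :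
    ∀ q : Q, CRG.Maximizable δ dist T q := by
  obtain ⟨m, hm, hfix, hleast⟩ := CRG.aux_lfp δ dist T
  obtain ⟨s, hs⟩ := CRG.aux_lower δ dist T m hm hfix
    (CRG.aux_prog δ dist T hRM m hm hfix hleast)
  intro q
  have hup := fun sA : CRG.Strat Q A => CRG.aux_upper δ dist T m hm hfix sA q
  haveI : Nonempty (CRG.Strat Q A) := ⟨CRG.ofPos s⟩
  refine ⟨CRG.ofPos s, le_antisymm ?_ ?_⟩
  · exact le_ciSup (f := fun sA : CRG.Strat Q A => CRG.valA δ dist T sA q)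
      ⟨m q, by rintro _ ⟨sA, rfl⟩; exact hup sA⟩ (CRG.ofPos s)
  · exact (ciSup_le hup).trans (hs q)
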